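/- The flow {φ_t^W} on M̂ = (Γ\PSL(2,ℝ)) × S¹ generated by W = (U, 0) + (0, α d/dθ) is uniquely ergodic. -/

import Mathlib

open MeasureTheory Filter Matrix MatrixGroups

instance : MeasurableSpace (Matrix (Fin 2) (Fin 2) ℝ) :=
  (MeasurableSpace.pi : MeasurableSpace (Fin 2 → Fin 2 → ℝ))
noncomputable instance : TopologicalSpace SL(2,ℝ) := instTopologicalSpaceSubtype
instance : MeasurableSpace SL(2,ℝ) := Subtype.instMeasurableSpace

/-- The generator `U = [[0,1],[0,0]]` of the positive horocycle flow: `exp(tU)`. -/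
noncomputable def horocycleMat (t : ℝ) : SL(2,ℝ) :=
  ⟨!![1, t; 0, 1], by simp [Matrix.det_fin_two_of]⟩

/-- `exp(tU)` as an element of `PSL(2, ℝ)`. -/
noncomputable def horocyclePSL (t : ℝ) : PSL(2, ℝ) := QuotientGroup.mk (horocycleMat t)

/-- The homogeneous space `M = Γ\PSL(2,ℝ)` of right cosets of a lattice `Γ`. -/
abbrev RightCosetSpace {G : Type*} [Group G] (Γ : Subgroup G) : Type _ :=
  Quotient (QuotientGroup.rightRel Γ)

/-- A flow `h` on `M`, where `M` carries the quotient σ-algebra of a surjection `π : X → M`, such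
that the orbit map is jointly measurable when its base point is read off in `X`. The orbit map
`ℝ × M → M` itself need not be measurable for the product σ-algebra. -/
structure IsFlowQuotient {X M : Type*} [MeasurableSpace X] [MeasurableSpace M]
    (π : X → M) (h : ℝ → M → M) : Prop where
  surjective : Function.Surjective π
  measurableSet_iff : ∀ s : Set M, MeasurableSet s ↔ MeasurableSet (π ⁻¹' s)
  measurable_lift : Measurable fun q : ℝ × X => h q.1 (π q.2)
  map_zero : ∀ x, h 0 x = x
  map_add : ∀ s t x, h (s + t) x = h s (h t x)

namespace IsFlowQuotient

variable {X M : Type*} [MeasurableSpace X] [MeasurableSpace M] {π : X → M} {h : ℝ → M → M}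

theorem measurable_iff (H : IsFlowQuotient π h) {Z : Type*} [MeasurableSpace Z] {f : M → Z} :
    Measurable f ↔ Measurable (f ∘ π) := by
  refine ⟨fun hf s hs => (H.measurableSet_iff _).1 (hf hs), fun hf s hs => ?_⟩
  exact (H.measurableSet_iff _).2 (hf hs)

theorem measurable_orbit (H : IsFlowQuotient π h) (x : M) : Measurable fun r => h r x := by
  obtain ⟨y, rfl⟩ := H.surjective x
  exact H.measurable_lift.comp (measurable_id.prodMk measurable_const)

theorem measurable_time (H : IsFlowQuotient π h) (t : ℝ) : Measurable (h t) :=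
  H.measurable_iff.2 (H.measurable_lift.comp (measurable_const.prodMk measurable_id))

theorem map_comm (H : IsFlowQuotient π h) (s t : ℝ) (x : M) : h s (h t x) = h t (h s x) := by
  rw [← H.map_add, ← H.map_add, add_comm]

theorem measurable_map_orbit (H : IsFlowQuotient π h) (ρ : Measure ℝ) [IsProbabilityMeasure ρ] :
    Measurable fun x => ρ.map fun r => h r x := by
  refine Measure.measurable_of_measurable_coe _ fun s hs => H.measurable_iff.2 ?_
  have : ((fun x => (ρ.map fun r => h r x) s) ∘ π) =
      fun y => ρ (Prod.mk y ⁻¹' {q : X × ℝ | h q.2 (π q.1) ∈ s}) := by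
    funext y
    simp only [Function.comp_apply]
    rw [Measure.map_apply (H.measurable_orbit _) hs]
    rfl
  rw [this]
  exact measurable_measure_prodMk_left ((H.measurable_lift.comp measurable_swap) hs)

theorem bind_map_orbit (H : IsFlowQuotient π h) {μ : Measure M} [IsProbabilityMeasure μ]
    (hinv : ∀ t, MeasurePreserving (h t) μ μ)
    (huniq : ∀ ν : Measure M, IsProbabilityMeasure ν →
      (∀ t, MeasurePreserving (h t) ν ν) → ν = μ)
    (ρ : Measure ℝ) [IsProbabilityMeasure ρ] :
    (μ.bind fun x => ρ.map fun r => h r x) = μ := by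
  have hκ := H.measurable_map_orbit ρ
  refine huniq _ ⟨?_⟩ fun t => ⟨H.measurable_time t, ?_⟩
  · rw [Measure.bind_apply MeasurableSet.univ hκ.aemeasurable]
    simp [Measure.map_apply (H.measurable_orbit _) MeasurableSet.univ]
  · ext s hs
    rw [Measure.map_apply (H.measurable_time t) hs,
      Measure.bind_apply (H.measurable_time t hs) hκ.aemeasurable,
      Measure.bind_apply hs hκ.aemeasurable,
      ← (hinv t).lintegral_comp (f := fun x => (ρ.map fun r => h r x) s)
        ((Measure.measurable_coe hs).comp hκ)]
    refine lintegral_congr fun x => ?_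
    rw [Measure.map_apply (H.measurable_orbit _) (H.measurable_time t hs),
      Measure.map_apply (H.measurable_orbit _) hs]
    congr 1
    ext r
    simp only [Set.mem_preimage]
    rw [H.map_comm]

/-- A measurable property holds almost everywhere for the unique invariant measure iff it holds at
almost every time along almost every orbit. -/
theorem ae_iff_ae_ae (H : IsFlowQuotient π h) {μ : Measure M} [IsProbabilityMeasure μ]
    (hinv : ∀ t, MeasurePreserving (h t) μ μ)
    (huniq : ∀ ν : Measure M, IsProbabilityMeasure ν →
      (∀ t, MeasurePreserving (h t) ν ν) → ν = μ)
    {p : M → Prop} (hp : MeasurableSet {x | p x}) :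
    (∀ᵐ x ∂μ, p x) ↔ ∀ᵐ x ∂μ, ∀ᵐ r : ℝ, p (h r x) := by
  set ρ := ProbabilityTheory.gaussianReal 0 1
  have hκ := H.measurable_map_orbit ρ
  have hpc : MeasurableSet {x | ¬ p x} := hp.compl
  have hρ (q : ℝ → Prop) : (∀ᵐ r ∂ρ, q r) ↔ ∀ᵐ r : ℝ, q r :=
    ⟨fun hq => (ProbabilityTheory.gaussianReal_absolutelyContinuous' 0 one_ne_zero).ae_le hq,
      fun hq => (ProbabilityTheory.gaussianReal_absolutelyContinuous 0 one_ne_zero).ae_le hq⟩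
  rw [ae_iff]
  nth_rw 1 [← H.bind_map_orbit hinv huniq ρ]
  rw [Measure.bind_apply hpc hκ.aemeasurable,
    lintegral_eq_zero_iff (f := fun x => (ρ.map fun r => h r x) {x | ¬ p x})
      ((Measure.measurable_coe hpc).comp hκ)]
  refine eventually_congr (Eventually.of_forall fun x => ?_)
  rw [← hρ, ae_iff]
  simp only [Pi.zero_apply]
  rw [Measure.map_apply (H.measurable_orbit _) hpc]
  rfl

end IsFlowQuotient

/-- A bounded measurable function with all rational numbers as almost-everywhere periods is almost
everywhere constant. -/
theorem ae_eq_const_of_ae_rat_periodic {f : ℝ → ℂ} (hf : Measurable f) {C : ℝ}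
    (hC : ∀ x, ‖f x‖ ≤ C) (hper : ∀ q : ℚ, ∀ᵐ r : ℝ, f (r + q) = f r) :
    ∃ c, ∀ᵐ r : ℝ, f r = c := by
  have hloc : LocallyIntegrable f volume := by
    refine (locallyIntegrable_const C).mono hf.aestronglyMeasurable ?_
    exact Eventually.of_forall fun x => (hC x).trans (le_abs_self C)
  have hint (a b : ℝ) : IntervalIntegrable f volume a b :=
    intervalIntegrable_iff.mpr <|
      (hloc.integrableOn_isCompact isCompact_uIcc).mono_set Set.uIoc_subset_uIcc
  set I : ℝ → ℂ := fun y => ∫ r in (0:ℝ)..y, f r with hI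
  have hcont : Continuous I := intervalIntegral.continuous_primitive hint 0
  have hadd (y t : ℝ) : I (t + y) = I t + I y := by
    have hclosed : IsClosed {t : ℝ | I (t + y) = I t + I y} :=
      isClosed_eq (by fun_prop) (by fun_prop)
    have hrat : Set.range ((↑) : ℚ → ℝ) ⊆ {t : ℝ | I (t + y) = I t + I y} := by
      rintro _ ⟨q, rfl⟩
      have h1 : ∫ r in (q:ℝ)..(q + y), f r = I y := by
        have := intervalIntegral.integral_comp_add_right (a := 0) (b := y) f (q : ℝ)
        rw [zero_add, add_comm y] at this
        rw [← this]
        refine intervalIntegral.integral_congr_ae ?_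
        filter_upwards [hper q] with r hr _ using hr
      simp only [Set.mem_ofPred_eq]
      rw [← h1, hI]
      exact (intervalIntegral.integral_add_adjacent_intervals (hint _ _) (hint _ _)).symm
    have := hclosed.closure_subset_iff.2 hrat
    rw [Rat.denseRange_cast.closure_range] at this
    exact this (Set.mem_univ t)
  let L : ℝ →+ ℂ := AddMonoidHom.mk' I fun t y => hadd y t
  have hlin (y : ℝ) : I y = y • I 1 := by
    have := map_real_smul L hcont y 1
    simpa [L] using this
  refine ⟨I 1, ?_⟩
  filter_upwards [LocallyIntegrable.ae_hasDerivAt_integral hloc] with r hr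
  have h1 : HasDerivAt I (f r) r := hr 0
  have h2 : HasDerivAt I ((1 : ℝ) • I 1) r := by
    have := (hasDerivAt_id r).smul_const (I 1)
    exact this.congr_of_eventuallyEq (Eventually.of_forall hlin)
  rw [h1.unique h2, one_smul]

/-- A bounded almost-everywhere solution of the twisted cocycle equation agrees almost everywhere
with a function which, along almost every orbit, solves it at all times. -/
theorem IsFlowQuotient.exists_eigenfunction {X M : Type*} [MeasurableSpace X] [MeasurableSpace M]
    {π : X → M} {h : ℝ → M → M}
    (H : IsFlowQuotient π h) {μ : Measure M} [IsProbabilityMeasure μ]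
    (hinv : ∀ t, MeasurePreserving (h t) μ μ)
    (huniq : ∀ ν : Measure M, IsProbabilityMeasure ν →
      (∀ t, MeasurePreserving (h t) ν ν) → ν = μ)
    {c : ℝ → M → ℂ} (hc : Measurable fun q : ℝ × X => c q.1 (π q.2))
    (hc1 : ∀ t x, ‖c t x‖ = 1) (hcadd : ∀ s t x, c (s + t) x = c s (h t x) * c t x)
    {g : M → ℂ} (hg : Measurable g) {C : ℝ} (hgC : ∀ x, ‖g x‖ ≤ C)
    (heq : ∀ t, ∀ᵐ x ∂μ, g (h t x) = c t x * g x) :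
    ∃ G : M → ℂ, Measurable G ∧ g =ᵐ[μ] G ∧ ∀ᵐ x ∂μ, ∀ t, G (h t x) = c t x * G x := by
  have hc0 (t x) : c t x ≠ 0 := fun h0 => by simpa [h0] using hc1 t x
  set ρ := ProbabilityTheory.gaussianReal 0 1
  have hρ : ρ ≪ volume := ProbabilityTheory.gaussianReal_absolutelyContinuous 0 one_ne_zero
  have hct (t) : Measurable (c t) :=
    H.measurable_iff.2 (hc.comp (measurable_const.prodMk measurable_id))
  have hcx (x) : Measurable fun t => c t x := by
    obtain ⟨y, rfl⟩ := H.surjective x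
    exact hc.comp (measurable_id.prodMk measurable_const)
  set F : M → ℝ → ℂ := fun x r => (c r x)⁻¹ * g (h r x) with hF
  have hFx (x) : Measurable (F x) := (hcx x).inv.mul (hg.comp (H.measurable_orbit x))
  have hFlift : Measurable fun q : X × ℝ => F (π q.1) q.2 :=
    (hc.comp measurable_swap).inv.mul (hg.comp (H.measurable_lift.comp measurable_swap))
  have hFshift (x t r) : F (h t x) r = c t x * F x (r + t) := by
    simp only [hF, hcadd, H.map_add]
    field_simp [hc0]
  set G : M → ℂ := fun x => ∫ r, F x r ∂ρ with hG
  have hGm : Measurable G :=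
    H.measurable_iff.2 hFlift.stronglyMeasurable.integral_prod_right'.measurable
  have hGc {x v} (hx : ∀ᵐ r : ℝ, F x r = v) : G x = v := by
    rw [hG]
    simp only
    rw [integral_congr_ae (hρ.ae_le hx)]
    simp
  have hconst : ∀ᵐ x ∂μ, ∃ v, ∀ᵐ r : ℝ, F x r = v := by
    have : ∀ᵐ x ∂μ, ∀ q : ℚ, ∀ᵐ r : ℝ, g (h q (h r x)) = c q (h r x) * g (h r x) := by
      refine ae_all_iff.2 fun q => ?_
      refine (H.ae_iff_ae_ae hinv huniq (p := fun x => g (h q x) = c q x * g x) ?_).1 (heq q)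
      exact measurableSet_eq_fun (hg.comp (H.measurable_time q)) ((hct q).mul hg)
    filter_upwards [this] with x hx
    refine ae_eq_const_of_ae_rat_periodic (hFx x) (C := C) (fun r => ?_) fun q => ?_
    · simpa [hF, hc1] using hgC _
    · filter_upwards [hx q] with r hr
      simp only [hF]
      rw [add_comm r, H.map_add, hr, hcadd]
      field_simp [hc0]
  have hGeq : ∀ᵐ x ∂μ, ∀ t, G (h t x) = c t x * G x := by
    filter_upwards [hconst] with x ⟨v, hv⟩ t
    rw [hGc hv]
    refine hGc ?_
    have := (measurePreserving_add_right volume t).quasiMeasurePreserving.ae hv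
    filter_upwards [this] with r hr
    rw [hFshift, hr]
  refine ⟨G, hGm, ?_, hGeq⟩
  refine (H.ae_iff_ae_ae hinv huniq (measurableSet_eq_fun hg hGm)).2 ?_
  filter_upwards [hconst, hGeq] with x ⟨v, hv⟩ hGx
  filter_upwards [hv] with r hr
  rw [hGx r, hGc hv, ← hr]
  simp only [hF]
  field_simp [hc0]

/-- A mixing family of transformations has no nonconstant continuous eigenvalue. -/
theorem ae_eq_zero_of_mixing_of_eigenfunction {M : Type*} [MeasurableSpace M] {μ : Measure M}
    [IsProbabilityMeasure μ] {T : ℝ → M → M} (hT : ∀ t, MeasurePreserving (T t) μ μ)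
    (hmix : ∀ A B : Set M, MeasurableSet A → MeasurableSet B →
      Tendsto (fun t : ℝ => μ (A ∩ T t ⁻¹' B)) atTop (nhds (μ A * μ B)))
    {k : ℤ} (hk : k ≠ 0) {G : M → ℂ} (hG : Measurable G)
    (heig : ∀ t : ℝ, ∀ᵐ x ∂μ, G (T t x) = fourier k (t : AddCircle (1 : ℝ)) * G x) :
    G =ᵐ[μ] 0 := by
  have hconst : ∃ v, G =ᵐ[μ] fun _ => v := by
    refine exists_eventuallyEq_const_of_forall_separating MeasurableSet fun U hU => ?_
    set B := G ⁻¹' U with hB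
    have hBm : MeasurableSet B := hG hU
    have hn (n : ℕ) : μ (B ∩ T n ⁻¹' B) = μ B := by
      refine measure_congr ?_
      filter_upwards [heig n] with x hx
      have h1 : fourier k ((n : ℝ) : AddCircle (1 : ℝ)) = 1 := by
        rw [show ((n : ℝ) : AddCircle (1 : ℝ)) = 0 by
          rw [AddCircle.coe_eq_zero_iff]; exact ⟨n, by simp⟩]
        exact fourier_eval_zero k
      rw [h1, one_mul] at hx
      refine propext ⟨fun h => h.1, fun h => ⟨h, ?_⟩⟩
      change G (T n x) ∈ U
      rw [hx]
      exact h
    have hlim := (hmix B B hBm hBm).comp tendsto_natCast_atTop_atTop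
    simp only [Function.comp_def, hn] at hlim
    have hsq : μ B = μ B * μ B := tendsto_nhds_unique tendsto_const_nhds hlim
    rcases eq_or_ne (μ B) 0 with h0 | h0
    · right
      exact measure_eq_zero_iff_ae_notMem.1 h0
    · left
      have h1 : μ B = 1 := by
        have := ENNReal.mul_right_inj h0 (measure_ne_top μ B) (b := 1) (c := μ B)
        rw [mul_one] at this
        exact (this.1 hsq).symm
      exact (mem_ae_iff_prob_eq_one hBm).2 h1
  obtain ⟨v, hv⟩ := hconst
  obtain ⟨t, hkt⟩ : ∃ t : ℝ, fourier k (t : AddCircle (1 : ℝ)) = -1 := by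
    refine ⟨1 / 2 / |k|, ?_⟩
    rw [fourier_coe_apply]
    have hk' : (k : ℂ) ≠ 0 := by exact_mod_cast hk
    rcases abs_choice k with h | h
    · rw [h]
      convert Complex.exp_pi_mul_I using 2
      push_cast
      field_simp
    · rw [h, ← Complex.exp_neg_pi_mul_I]
      congr 1
      push_cast
      field_simp
  have hv0 : v = 0 := by
    have h1 := (hT t).quasiMeasurePreserving.ae hv
    obtain ⟨x, hx1, hx2, hx3⟩ := (h1.and (hv.and (heig t))).exists
    rw [hx1, hx2, hkt] at hx3
    exact self_eq_neg.1 (by simpa using hx3)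
  rw [hv0] at hv
  exact hv

theorem integral_fourier_eq_zero (μ : Measure (AddCircle (1 : ℝ))) [μ.IsAddHaarMeasure] {k : ℤ}
    (hk : k ≠ 0) : ∫ θ, fourier k θ ∂μ = 0 :=
  integral_eq_zero_of_add_right_eq_neg (fourier_add_half_inv_index hk one_pos)

/-- A probability measure on the circle whose nonzero Fourier coefficients vanish is the Haar
measure. -/
theorem eq_addHaar_of_integral_fourier_eq_zero (μ ν : Measure (AddCircle (1 : ℝ)))
    [IsProbabilityMeasure μ] [IsProbabilityMeasure ν] [ν.IsAddHaarMeasure]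
    (hμ : ∀ k : ℤ, k ≠ 0 → ∫ θ, fourier k θ ∂μ = 0) : μ = ν := by
  have hint (η : Measure (AddCircle (1 : ℝ))) [IsProbabilityMeasure η]
      (f : C(AddCircle (1 : ℝ), ℂ)) : Integrable f η :=
    f.continuous.integrable_of_hasCompactSupport (HasCompactSupport.of_compactSpace f)
  have hcont (η : Measure (AddCircle (1 : ℝ))) [IsProbabilityMeasure η] :
      Continuous fun f : C(AddCircle (1 : ℝ), ℂ) => ∫ θ, f θ ∂η := by
    refine continuous_iff_continuousAt.2 fun f => ?_
    refine Metric.continuousAt_iff.2 fun ε hε => ⟨ε, hε, fun g hg => ?_⟩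
    rw [dist_eq_norm, ← integral_sub (hint η g) (hint η f)]
    refine lt_of_le_of_lt (norm_integral_le_of_norm_le_const (C := dist g f) ?_) (by simpa)
    exact Eventually.of_forall fun θ => by
      rw [← dist_eq_norm]; exact ContinuousMap.dist_apply_le_dist θ
  have hall (f : C(AddCircle (1 : ℝ), ℂ)) : ∫ θ, f θ ∂μ = ∫ θ, f θ ∂ν := by
    have hclosed : IsClosed {f : C(AddCircle (1 : ℝ), ℂ) | ∫ θ, f θ ∂μ = ∫ θ, f θ ∂ν} :=
      isClosed_eq (hcont μ) (hcont ν)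
    have hspan : (Submodule.span ℂ (Set.range (@fourier 1)) : Set C(AddCircle (1 : ℝ), ℂ)) ⊆
        {f | ∫ θ, f θ ∂μ = ∫ θ, f θ ∂ν} := by
      intro f hf
      induction hf using Submodule.span_induction with
      | mem f hf =>
        obtain ⟨k, rfl⟩ := hf
        rcases eq_or_ne k 0 with rfl | hk
        · simp
        · exact (hμ k hk).trans (integral_fourier_eq_zero ν hk).symm
      | zero => simp
      | add f g _ _ hf hg =>
        simp only [Set.mem_ofPred_eq, ContinuousMap.add_apply] at *
        rw [integral_add (hint μ f) (hint μ g), integral_add (hint ν f) (hint ν g), hf, hg]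
      | smul a f _ hf =>
        simp only [Set.mem_ofPred_eq, ContinuousMap.smul_apply] at *
        rw [integral_smul, integral_smul, hf]
    have htop : f ∈ closure
        (Submodule.span ℂ (Set.range (@fourier 1)) : Set C(AddCircle (1 : ℝ), ℂ)) := by
      have := (span_fourier_closure_eq_top (T := 1)).ge (Submodule.mem_top (x := f))
      exact this
    exact hclosed.closure_subset_iff.2 hspan htop
  refine ext_of_forall_integral_eq_of_IsFiniteMeasure fun f => ?_
  have := hall ⟨fun θ => (f θ : ℂ), Complex.continuous_ofReal.comp f.continuous⟩
  simp only [ContinuousMap.coe_mk] at this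
  rw [integral_complex_ofReal, integral_complex_ofReal] at this
  exact_mod_cast this

theorem fourier_add_right (k : ℤ) (x y : AddCircle (1 : ℝ)) :
    fourier k (x + y) = fourier k x * fourier k y := by
  simp [fourier_apply, smul_add, AddCircle.toCircle_add]

theorem norm_fourier_apply (k : ℤ) (x : AddCircle (1 : ℝ)) : ‖fourier k x‖ = 1 := by
  rw [fourier_apply]
  exact Circle.norm_coe _

/-- The `k`-th Fourier coefficient of the conditional measure of `ν` on the circle over `x`. -/
noncomputable def condFourier {M : Type*} [MeasurableSpace M] (ν : Measure (M × AddCircle (1 : ℝ)))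
    [IsFiniteMeasure ν] (k : ℤ) (x : M) : ℂ :=
  ∫ θ, fourier k θ ∂(ν.condKernel x)

section condFourier

variable {M : Type*} [MeasurableSpace M] (ν : Measure (M × AddCircle (1 : ℝ)))

theorem measurable_fourier_snd (k : ℤ) :
    Measurable fun p : M × AddCircle (1 : ℝ) => fourier k p.2 :=
  (fourier k).continuous.measurable.comp measurable_snd

theorem measurable_condFourier [IsFiniteMeasure ν] (k : ℤ) : Measurable (condFourier ν k) :=
  (StronglyMeasurable.integral_kernel_prod_right' (κ := ν.condKernel)
    (measurable_fourier_snd k).stronglyMeasurable).measurable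

theorem norm_condFourier_le [IsFiniteMeasure ν] (k : ℤ) (x : M) : ‖condFourier ν k x‖ ≤ 1 := by
  have := norm_integral_le_of_norm_le_const (μ := ν.condKernel x) (f := fourier k) (C := 1)
    (Eventually.of_forall fun θ => (norm_fourier_apply k θ).le)
  rwa [probReal_univ, mul_one] at this

theorem integral_mul_fourier_snd [IsFiniteMeasure ν] (k : ℤ) {w : M → ℂ} (hw : Measurable w)
    (hw1 : ∀ x, ‖w x‖ ≤ 1) :
    ∫ p, w p.1 * fourier k p.2 ∂ν = ∫ x, w x * condFourier ν k x ∂ν.fst := by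
  have hint : Integrable (fun p : M × AddCircle (1 : ℝ) => w p.1 * fourier k p.2)
      (ν.fst.compProd ν.condKernel) := by
    refine Integrable.of_bound
      ((hw.comp measurable_fst).mul (measurable_fourier_snd k)).aestronglyMeasurable 1
      (Eventually.of_forall fun p => ?_)
    rw [norm_mul, norm_fourier_apply, mul_one]
    exact hw1 p.1
  nth_rw 1 [← ν.disintegrate ν.condKernel]
  rw [Measure.integral_compProd hint]
  refine integral_congr_ae (Eventually.of_forall fun x => ?_)
  exact integral_const_mul (w x) fun θ => fourier k θ

/-- The conditional Fourier coefficients of a measure invariant under a skew product by circle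
rotations solve the associated twisted cocycle equation. -/
theorem condFourier_skew [IsFiniteMeasure ν] {S S' : M → M} (hS' : Measurable S')
    (hSS' : ∀ x, S' (S x) = x) (hS : MeasurePreserving S ν.fst ν.fst)
    {a : M → AddCircle (1 : ℝ)} (ha : Measurable a)
    (hφ : MeasurePreserving (fun p : M × AddCircle (1 : ℝ) => (S p.1, p.2 + a p.1)) ν ν) (k : ℤ) :
    ∀ᵐ x ∂ν.fst, condFourier ν k (S x) = fourier k (a x) * condFourier ν k x := by
  have hgm := measurable_condFourier ν k
  have hcm : Measurable fun x => fourier k (a x) := (fourier k).continuous.measurable.comp ha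
  refine Integrable.ae_eq_of_forall_setIntegral_eq _ _ ?_ ?_ fun P hP _ => ?_
  · exact Integrable.of_bound (hgm.comp hS.measurable).aestronglyMeasurable 1
      (Eventually.of_forall fun x => norm_condFourier_le ν k _)
  · refine Integrable.of_bound (hcm.mul hgm).aestronglyMeasurable 1
      (Eventually.of_forall fun x => ?_)
    rw [norm_mul, norm_fourier_apply, one_mul]
    exact norm_condFourier_le ν k x
  set w : M → ℂ := (S' ⁻¹' P).indicator 1 with hw
  have hwm : Measurable w := measurable_one.indicator (hS' hP)
  have hw1 (x) : ‖w x‖ ≤ 1 := by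
    by_cases hx : x ∈ S' ⁻¹' P
    · simp [hw, Set.indicator_of_mem hx]
    · simp [hw, Set.indicator_of_notMem hx]
  have hwS (x) : w (S x) = P.indicator 1 x := by
    by_cases hx : x ∈ P
    · rw [hw, Set.indicator_of_mem hx, Set.indicator_of_mem (by simpa [hSS'] using hx)]
      rfl
    · rw [hw, Set.indicator_of_notMem hx, Set.indicator_of_notMem (by simpa [hSS'] using hx)]
  have hind (f : M → ℂ) : ∫ x, P.indicator 1 x * f x ∂ν.fst = ∫ x in P, f x ∂ν.fst := by
    rw [← integral_indicator hP]
    refine integral_congr_ae (Eventually.of_forall fun x => ?_)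
    by_cases hx : x ∈ P <;> simp [hx]
  calc ∫ x in P, condFourier ν k (S x) ∂ν.fst
      = ∫ x, w (S x) * condFourier ν k (S x) ∂ν.fst := by
        simp only [hwS]
        exact (hind _).symm
    _ = ∫ x, w x * condFourier ν k x ∂ν.fst := by
        rw [← integral_map (φ := S) (f := fun x => w x * condFourier ν k x)
          hS.measurable.aemeasurable (hwm.mul hgm).aestronglyMeasurable, hS.map_eq]
    _ = ∫ p, w p.1 * fourier k p.2 ∂ν := (integral_mul_fourier_snd ν k hwm hw1).symm
    _ = ∫ p, w (S p.1) * fourier k (p.2 + a p.1) ∂ν := by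
        rw [← integral_map (μ := ν) (φ := fun p : M × AddCircle (1 : ℝ) => (S p.1, p.2 + a p.1))
          (f := fun p : M × AddCircle (1 : ℝ) => w p.1 * fourier k p.2)
          hφ.measurable.aemeasurable
          ((hwm.comp measurable_fst).mul (measurable_fourier_snd k)).aestronglyMeasurable,
          hφ.map_eq]
    _ = ∫ p, (P.indicator 1 p.1 * fourier k (a p.1)) * fourier k p.2 ∂ν := by
        refine integral_congr_ae (Eventually.of_forall fun p => ?_)
        simp only [hwS, fourier_add_right]
        ring
    _ = ∫ x, (P.indicator 1 x * fourier k (a x)) * condFourier ν k x ∂ν.fst := by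
        refine integral_mul_fourier_snd ν k ((measurable_one.indicator hP).mul hcm) fun x => ?_
        rw [Pi.mul_apply, norm_mul, norm_fourier_apply, mul_one]
        by_cases hx : x ∈ P <;> simp [hx]
    _ = ∫ x in P, fourier k (a x) * condFourier ν k x ∂ν.fst := by
        simp only [mul_assoc]
        exact hind _

end condFourier

/-- Unique ergodicity of the circle extension of a uniquely ergodic flow by the cocycle
`∫₀ᵗ α(h s x) ds`, when the time change of the flow by `α` is mixing. -/
theorem IsFlowQuotient.eq_prod_of_twisted {X M : Type*} [MeasurableSpace X] [MeasurableSpace M]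
    {π : X → M} {h : ℝ → M → M}
    (H : IsFlowQuotient π h) {μ : Measure M} [IsProbabilityMeasure μ]
    (hinv : ∀ t, MeasurePreserving (h t) μ μ)
    (huniq : ∀ ν : Measure M, IsProbabilityMeasure ν →
      (∀ t, MeasurePreserving (h t) ν ν) → ν = μ)
    {α : M → ℝ} (hαm : Measurable α) (hαorb : ∀ x, Continuous fun s => α (h s x))
    (hαpos : ∀ x, 0 < α x) (hαnorm : ∫ x, α x ∂μ = 1)
    {ζ : M → ℝ → ℝ} {T : ℝ → M → M} (hT : ∀ t x, T t x = h (ζ x t) x) (hζ0 : ∀ x, ζ x 0 = 0)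
    (hζ : ∀ x t, HasDerivAt (ζ x) ((α (T t x))⁻¹) t)
    {μα : Measure M} (hμα : μα = μ.withDensity fun x => ENNReal.ofReal (α x))
    (hTinv : ∀ t, MeasurePreserving (T t) μα μα)
    (hmix : ∀ A B : Set M, MeasurableSet A → MeasurableSet B →
      Tendsto (fun t : ℝ => μα (A ∩ T t ⁻¹' B)) atTop (nhds (μα A * μα B)))
    (Leb : Measure (AddCircle (1 : ℝ))) [Leb.IsAddHaarMeasure] [IsProbabilityMeasure Leb]
    {φ : ℝ → M × AddCircle (1 : ℝ) → M × AddCircle (1 : ℝ)}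
    (hφ : ∀ t p, φ t p =
      (h t p.1, p.2 + ((∫ s in (0:ℝ)..t, α (h s p.1) : ℝ) : AddCircle (1 : ℝ))))
    (ν : Measure (M × AddCircle (1 : ℝ))) [IsProbabilityMeasure ν]
    (hν : ∀ t, MeasurePreserving (φ t) ν ν) : ν = μ.prod Leb := by
  set A : ℝ → M → ℝ := fun t x => ∫ s in (0:ℝ)..t, α (h s x) with hA
  have hAcont (x) : Continuous fun t => A t x :=
    intervalIntegral.continuous_primitive (f := fun s => α (h s x)) (μ := volume)
      (fun a b => (hαorb x).intervalIntegrable a b) 0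
  have hAadd (s t x) : A (s + t) x = A s (h t x) + A t x := by
    have h1 := intervalIntegral.integral_comp_add_right (a := 0) (b := s) (fun r => α (h r x)) t
    simp only [zero_add, H.map_add] at h1
    have h2 := intervalIntegral.integral_add_adjacent_intervals (μ := volume)
      ((hαorb x).intervalIntegrable 0 t) ((hαorb x).intervalIntegrable t (s + t))
    simp only [hA, h1]
    linarith
  have hAlift : Measurable fun q : ℝ × X => A q.1 (π q.2) := by
    refine measurable_uncurry_of_continuous_of_measurable (u := fun t y => A t (π y))
      (fun y => hAcont _) fun t => ?_
    have hm : StronglyMeasurable fun q : X × ℝ => α (h q.2 (π q.1)) :=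
      (hαm.comp (H.measurable_lift.comp measurable_swap)).stronglyMeasurable
    exact (hm.integral_prod_right'.sub hm.integral_prod_right').measurable
  have hAζ (x t) : A (ζ x t) x = t := by
    have hd (t) : HasDerivAt (fun t => A (ζ x t) x - t) 0 t := by
      have h1 : HasDerivAt (fun t => A t x) (α (h (ζ x t) x)) (ζ x t) :=
        intervalIntegral.integral_hasDerivAt_right ((hαorb x).intervalIntegrable _ _)
          ((hαorb x).stronglyMeasurableAtFilter _ _) (hαorb x).continuousAt
      have h2 := (h1.comp t (hζ x t)).sub (hasDerivAt_id t)
      rw [hT, mul_inv_cancel₀ (hαpos _).ne', sub_self] at h2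
      exact h2
    have := is_const_of_deriv_eq_zero (fun t => (hd t).differentiableAt) (fun t => (hd t).deriv) t 0
    simp only [hζ0, hA, intervalIntegral.integral_same, sub_zero] at this
    simp only [hA]
    linarith
  have hαint : Integrable α μ := by
    by_contra hn
    rw [integral_undef hn] at hαnorm
    exact zero_ne_one hαnorm
  have : IsProbabilityMeasure μα := by
    refine ⟨?_⟩
    rw [hμα, withDensity_apply _ MeasurableSet.univ, Measure.restrict_univ,
      ← ofReal_integral_eq_lintegral_ofReal hαint (Eventually.of_forall fun x => (hαpos x).le),
      hαnorm, ENNReal.ofReal_one]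
  have hμα_ac : μα ≪ μ := hμα ▸ withDensity_absolutelyContinuous _ _
  have hμ_ac : μ ≪ μα := by
    rw [hμα]
    refine withDensity_absolutelyContinuous' hαm.ennreal_ofReal.aemeasurable ?_
    exact Eventually.of_forall fun x => by simpa using hαpos x
  have hfst : ν.fst = μ := by
    refine huniq _ inferInstance fun t => ⟨H.measurable_time t, ?_⟩
    rw [Measure.fst, Measure.map_map (H.measurable_time t) measurable_fst]
    have : h t ∘ Prod.fst = Prod.fst ∘ φ t := by
      funext p
      simp [hφ]
    rw [this, ← Measure.map_map measurable_fst (hν t).measurable, (hν t).map_eq]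
  have hdis : μ.compProd ν.condKernel = ν := by
    rw [← hfst]
    exact ν.disintegrate _
  have hzero (k : ℤ) (hk : k ≠ 0) : ∀ᵐ x ∂μ, condFourier ν k x = 0 := by
    set c : ℝ → M → ℂ := fun t x => fourier k (A t x : AddCircle (1 : ℝ)) with hc
    have hcm : Measurable fun q : ℝ × X => c q.1 (π q.2) :=
      ((fourier k).continuous.comp (AddCircle.continuous_mk' 1)).measurable.comp hAlift
    have hAt (t) : Measurable fun x => (A t x : AddCircle (1 : ℝ)) :=
      (AddCircle.continuous_mk' 1).measurable.comp
        (H.measurable_iff.2 (hAlift.comp (measurable_const.prodMk measurable_id)))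
    have heq (t) : ∀ᵐ x ∂μ, condFourier ν k (h t x) = c t x * condFourier ν k x := by
      rw [← hfst]
      refine condFourier_skew ν (H.measurable_time (-t)) (fun x => ?_) ?_ (hAt t) ?_ k
      · rw [← H.map_add, neg_add_cancel, H.map_zero]
      · rw [hfst]
        exact hinv t
      · rw [← funext (hφ t)]
        exact hν t
    obtain ⟨G, hGm, hgG, hGeq⟩ := H.exists_eigenfunction hinv huniq hcm
      (fun t x => norm_fourier_apply _ _)
      (fun s t x => by simp only [hc, hAadd, AddCircle.coe_add, fourier_add_right])
      (measurable_condFourier ν k) (norm_condFourier_le ν k) heq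
    have hG0 : G =ᵐ[μα] 0 := by
      refine ae_eq_zero_of_mixing_of_eigenfunction hTinv hmix hk hGm fun t => ?_
      filter_upwards [hμα_ac.ae_le hGeq] with x hx
      rw [hT, hx]
      simp only [hc, hAζ]
    filter_upwards [hgG, hμ_ac.ae_le hG0] with x hx hx0
    rw [hx, hx0]
    rfl
  have hκ : ∀ᵐ x ∂μ, ν.condKernel x = ProbabilityTheory.Kernel.const M Leb x := by
    have : ∀ᵐ x ∂μ, ∀ k : ℤ, k ≠ 0 → condFourier ν k x = 0 :=
      ae_all_iff.2 fun k => by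
        by_cases hk : k = 0
        · simp [hk]
        · filter_upwards [hzero k hk] with x hx _ using hx
    filter_upwards [this] with x hx
    rw [ProbabilityTheory.Kernel.const_apply]
    exact eq_addHaar_of_integral_fourier_eq_zero _ Leb hx
  rw [← hdis, Measure.compProd_congr hκ, Measure.compProd_const]

instance : BorelSpace SL(2,ℝ) :=
  haveI : BorelSpace (Matrix (Fin 2) (Fin 2) ℝ) :=
    inferInstanceAs (BorelSpace (Fin 2 → Fin 2 → ℝ))
  Subtype.borelSpace _

theorem horocycleMat_zero : horocycleMat 0 = 1 := by
  ext i j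
  fin_cases i <;> fin_cases j <;> simp [horocycleMat]

theorem horocycleMat_add (s t : ℝ) :
    horocycleMat (s + t) = horocycleMat t * horocycleMat s := by
  ext i j
  change _ = ((horocycleMat t).1 * (horocycleMat s).1) i j
  fin_cases i <;> fin_cases j <;> simp [horocycleMat]

theorem continuous_mul_horocycleMat :
    Continuous fun q : ℝ × SL(2,ℝ) => q.2 * horocycleMat q.1 := by
  refine Continuous.subtype_mk (f := fun q : ℝ × SL(2,ℝ) =>
    (q.2 : Matrix (Fin 2) (Fin 2) ℝ) * !![1, q.1; 0, 1]) ?_ _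
  have h : Continuous fun q : ℝ × SL(2,ℝ) => !![1, q.1; 0, 1] := by
    refine continuous_matrix fun i j => ?_
    fin_cases i <;> fin_cases j <;> simp <;> fun_prop
  exact (continuous_subtype_val.comp continuous_snd).matrix_mul h

/-- The projection `SL(2,ℝ) → Γ\PSL(2,ℝ)`. -/
def toRightCosetSpace (Γ : Subgroup PSL(2, ℝ)) (y : SL(2,ℝ)) : RightCosetSpace Γ :=
  Quotient.mk (QuotientGroup.rightRel Γ) (QuotientGroup.mk y)

theorem continuous_toRightCosetSpace (Γ : Subgroup PSL(2, ℝ)) :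
    Continuous (toRightCosetSpace Γ) :=
  continuous_quotient_mk'.comp continuous_quotient_mk'

theorem horocycle_toRightCosetSpace {Γ : Subgroup PSL(2, ℝ)}
    {hU : ℝ → RightCosetSpace Γ → RightCosetSpace Γ}
    (hhU : ∀ t : ℝ, ∀ g : PSL(2, ℝ),
      hU t (Quotient.mk (QuotientGroup.rightRel Γ) g) =
        Quotient.mk (QuotientGroup.rightRel Γ) (g * horocyclePSL t)) (t : ℝ) (y : SL(2,ℝ)) :
    hU t (toRightCosetSpace Γ y) = toRightCosetSpace Γ (y * horocycleMat t) :=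
  hhU t _

theorem surjective_toRightCosetSpace (Γ : Subgroup PSL(2, ℝ)) :
    Function.Surjective (toRightCosetSpace Γ) :=
  Quotient.mk_surjective.comp Quotient.mk_surjective

theorem measurable_toRightCosetSpace (Γ : Subgroup PSL(2, ℝ)) :
    Measurable (toRightCosetSpace Γ) :=
  fun _ hs => hs

theorem isFlowQuotient_horocycle {Γ : Subgroup PSL(2, ℝ)}
    {hU : ℝ → RightCosetSpace Γ → RightCosetSpace Γ}
    (hhU : ∀ t : ℝ, ∀ g : PSL(2, ℝ),
      hU t (Quotient.mk (QuotientGroup.rightRel Γ) g) =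
        Quotient.mk (QuotientGroup.rightRel Γ) (g * horocyclePSL t)) :
    IsFlowQuotient (toRightCosetSpace Γ) hU where
  surjective := surjective_toRightCosetSpace Γ
  measurableSet_iff _ := Iff.rfl
  measurable_lift := by
    simp only [horocycle_toRightCosetSpace hhU]
    have hmul : Measurable fun q : ℝ × SL(2,ℝ) => q.2 * horocycleMat q.1 :=
      haveI : SecondCountableTopology (Matrix (Fin 2) (Fin 2) ℝ) :=
        inferInstanceAs (SecondCountableTopology (Fin 2 → Fin 2 → ℝ))
      haveI : SecondCountableTopology SL(2,ℝ) := TopologicalSpace.Subtype.secondCountableTopology _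
      continuous_mul_horocycleMat.measurable
    exact (measurable_toRightCosetSpace Γ).comp hmul
  map_zero x := by
    obtain ⟨y, rfl⟩ := surjective_toRightCosetSpace Γ x
    rw [horocycle_toRightCosetSpace hhU, horocycleMat_zero, mul_one]
  map_add s t x := by
    obtain ⟨y, rfl⟩ := surjective_toRightCosetSpace Γ x
    simp only [horocycle_toRightCosetSpace hhU, horocycleMat_add, mul_assoc]

/-- **Proposition (unique ergodicity of the twisted horocycle flow).**
Let `Γ` be a cocompact lattice in `PSL(2,ℝ)`, `M = Γ\PSL(2,ℝ)` and
`M̂ = M × S¹`.  Let `hU` be the uniquely ergodic horocycle flow on `M`, preserving the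
probability volume `vol`, and let `α ∈ C^∞(M)` be positive with `∫ α dvol = 1`, whose
time-changed flow `hα` (generated by `U_α = U/α`, preserving `vol_α = α·vol`) is
mixing.  Then the twisted horocycle flow
`φ_t^W (x, θ) = (hU t x, θ + ∫₀^t α(hU s x) ds)` on `M̂`, generated by
`W = (U, 0) + (0, α d/dθ)`, is uniquely ergodic: the only `φ^W`-invariant Borel
probability measure on `M̂` is `vol ⊗ Leb`. -/
theorem twisted_horocycle_flow_uniquely_ergodic
    (Γ : Subgroup PSL(2, ℝ)) [CompactSpace (RightCosetSpace Γ)]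
    -- the horocycle flow hU on M = Γ\PSL(2,ℝ)
    (hU : ℝ → RightCosetSpace Γ → RightCosetSpace Γ)
    (hhU : ∀ t : ℝ, ∀ g : PSL(2, ℝ),
      hU t (Quotient.mk (QuotientGroup.rightRel Γ) g) =
        Quotient.mk (QuotientGroup.rightRel Γ) (g * horocyclePSL t))
    -- the invariant probability volume, and unique ergodicity of hU
    (vol : Measure (RightCosetSpace Γ)) [IsProbabilityMeasure vol]
    (hvolinv : ∀ t : ℝ, MeasurePreserving (hU t) vol vol)
    (huniq : ∀ ν : Measure (RightCosetSpace Γ), IsProbabilityMeasure ν →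
      (∀ t : ℝ, MeasurePreserving (hU t) ν ν) → ν = vol)
    -- the smooth positive time-change function α, normalised
    (α : RightCosetSpace Γ → ℝ) (hαcont : Continuous α) (hαpos : ∀ x, 0 < α x)
    (hαnorm : ∫ x, α x ∂vol = 1)
    -- the time-changed horocycle flow hα generated by U_α = U/α, via its
    -- reparametrisation ζ, preserving vol_α = α·vol and mixing
    (ζ : RightCosetSpace Γ → ℝ → ℝ) (hα : ℝ → RightCosetSpace Γ → RightCosetSpace Γ)
    (hhα : ∀ t x, hα t x = hU (ζ x t) x)
    (hζ0 : ∀ x, ζ x 0 = 0)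
    (hζ : ∀ x t, HasDerivAt (ζ x) ((α (hα t x))⁻¹) t)
    (volα : Measure (RightCosetSpace Γ))
    (hvolα : volα = vol.withDensity fun x => ENNReal.ofReal (α x))
    (hvolαinv : ∀ t : ℝ, MeasurePreserving (hα t) volα volα)
    (hmix : ∀ A B : Set (RightCosetSpace Γ), MeasurableSet A → MeasurableSet B →
      Tendsto (fun t : ℝ => volα (A ∩ (hα t) ⁻¹' B)) atTop (nhds (volα A * volα B)))
    -- the Lebesgue (Haar) probability measure on the circle S¹ = ℝ/ℤ
    (Leb : Measure (AddCircle (1 : ℝ)))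
    [Leb.IsAddHaarMeasure] [IsProbabilityMeasure Leb]
    -- the twisted horocycle flow φW, generated by W = (U,0) + (0, α d/dθ)
    (φW : ℝ → RightCosetSpace Γ × AddCircle (1 : ℝ) →
      RightCosetSpace Γ × AddCircle (1 : ℝ))
    (hφW : ∀ t : ℝ, ∀ p : RightCosetSpace Γ × AddCircle (1 : ℝ),
      φW t p = (hU t p.1, p.2 + (((∫ s in (0:ℝ)..t, α (hU s p.1)) : ℝ) : AddCircle (1:ℝ)))) :
    -- conclusion: unique ergodicity of φW
    ∀ ν : Measure (RightCosetSpace Γ × AddCircle (1 : ℝ)), IsProbabilityMeasure ν →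
      (∀ t : ℝ, MeasurePreserving (φW t) ν ν) → ν = vol.prod Leb := by
  intro ν _ hν
  have H := isFlowQuotient_horocycle hhU
  have hαm : Measurable α :=
    H.measurable_iff.2 (hαcont.comp (continuous_toRightCosetSpace Γ)).measurable
  have hαorb (x : RightCosetSpace Γ) : Continuous fun s => α (hU s x) := by
    obtain ⟨y, rfl⟩ := surjective_toRightCosetSpace Γ x
    simp only [horocycle_toRightCosetSpace hhU]
    exact hαcont.comp ((continuous_toRightCosetSpace Γ).comp
      (continuous_mul_horocycleMat.comp (continuous_id.prodMk continuous_const)))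
  exact H.eq_prod_of_twisted hvolinv huniq hαm hαorb hαpos hαnorm hhα hζ0 hζ hvolα hvolαinv hmix
    Leb hφW ν hν
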